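/- arXiv:1602.04131 — 2 statements merged into one kernel-verified Lean document; each statement's English description precedes it below -/
import Mathlib

section
/- For every finite simplicial complex K equipped with a simplex-wise linear embedding |K| ⊆ ℝⁿ, there exist a real number ε > 0 and a finite subset X ⊆ |K| such that the Rips complex R(X;ε) is homotopy equivalent to K. Consequently, every finite simplicial complex that is PL-embeddable in ℝⁿ is homotopy equivalent to the Rips complex of some finite subset of ℝⁿ. -/
open Metric Function

/-- The geometric realization of the Rips complex `R(X; r)` of a set
`X ⊆ ℝⁿ` at scale `r`: formal convex combinations of the points of `X` whose support is
a face of `R(X; r)` (i.e. a finite subset of `X` of diameter `< r`), topologized as a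
subspace of the product `(ℝⁿ) → ℝ`. (For finite `X` this carries the usual topology of
the geometric realization.) -/
def ripsRealization {n : ℕ} (X : Set (EuclideanSpace ℝ (Fin n))) (r : ℝ) :
    Set ((EuclideanSpace ℝ (Fin n)) → ℝ) :=
  {f | (∀ v, 0 ≤ f v) ∧ (support f).Finite ∧ support f ⊆ X ∧
    Metric.diam (support f) < r ∧ ∑ᶠ v, f v = 1}

open scoped ContinuousMap

section Realization

variable {W : Type*}

/-- The geometric realization of a family `L` of finite sets closed under passing to subsets:
convex combinations of vertices supported in a member of `L`. -/
def realization (L : Set (Finset W)) : Set (W → ℝ) :=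
  {f | (∀ w, 0 ≤ f w) ∧ ∃ σ ∈ L, support f ⊆ σ ∧ ∑ w ∈ σ, f w = 1}

/-- Shift the smallest of the weights on `α` from every vertex of `α` to `m`, up to the
fraction `t`. -/
noncomputable def shiftWeight [DecidableEq W] {α : Finset W} (hα : α.Nonempty) (m : W)
    (t : ℝ) (f : W → ℝ) : W → ℝ := fun w =>
  f w + t * α.inf' hα f * ((if w = m then (α.card : ℝ) else 0) - if w ∈ α then 1 else 0)

variable {L : Set (Finset W)} {α : Finset W} {m : W} {f : W → ℝ}

lemma eq_zero_of_support_subset {σ : Finset W} (h : support f ⊆ σ) {w : W} (hw : w ∉ σ) :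
    f w = 0 := by
  by_contra h0
  exact hw (h h0)

/-- Relabelling the vertices along an injection does not change the realization. -/
theorem nonempty_homotopyEquiv_of_injective {V : Type*} (ι : V ↪ W) (L : Set (Finset V)) :
    Nonempty (realization ((Finset.map ι) '' L) ≃ₕ realization L) := by
  have hcomp : ∀ f ∈ realization ((Finset.map ι) '' L), f ∘ ι ∈ realization L := by
    rintro f ⟨hf0, _, ⟨σ, hσ, rfl⟩, hsupp, hsum⟩
    refine ⟨fun v => hf0 _, σ, hσ, fun v hv => ?_, by simpa using hsum⟩
    simpa using hsupp (show ι v ∈ support f from hv)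
  have hext : ∀ g ∈ realization L, extend ι g 0 ∈ realization ((Finset.map ι) '' L) := by
    rintro g ⟨hg0, σ, hσ, hsupp, hsum⟩
    refine ⟨fun w => ?_, _, ⟨σ, hσ, rfl⟩, fun w hw => ?_, ?_⟩
    · by_cases hw : ∃ v, ι v = w
      · obtain ⟨v, rfl⟩ := hw
        simpa [ι.injective.extend_apply] using hg0 v
      · simp [extend_apply' _ _ _ hw]
    · by_cases hv : ∃ v, ι v = w
      · obtain ⟨v, rfl⟩ := hv
        rw [mem_support, ι.injective.extend_apply] at hw
        simpa using hsupp hw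
      · exact absurd (extend_apply' g (0 : W → ℝ) w hv) hw
    · simpa [ι.injective.extend_apply] using hsum
  refine ⟨Homeomorph.toHomotopyEquiv ⟨⟨fun f => ⟨f.1 ∘ ι, hcomp f f.2⟩,
    fun g => ⟨extend ι g.1 0, hext g g.2⟩, fun f => ?_, fun g => ?_⟩, ?_, ?_⟩⟩
  · refine Subtype.ext (funext fun w => ?_)
    obtain ⟨f, hf0, _, ⟨σ, hσ, rfl⟩, hsupp, hsum⟩ := f
    by_cases hw : ∃ v, ι v = w
    · obtain ⟨v, rfl⟩ := hw
      simp [ι.injective.extend_apply]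
    · have : w ∉ σ.map ι := fun h => hw (by
        obtain ⟨v, -, hv⟩ := Finset.mem_map.1 h
        exact ⟨v, hv⟩)
      simp [extend_apply' _ _ _ hw, eq_zero_of_support_subset hsupp this]
  · exact Subtype.ext (extend_comp ι.injective _ _)
  · have h : Continuous fun f : W → ℝ => f ∘ ι := by fun_prop
    exact (h.comp continuous_subtype_val).subtype_mk _
  · refine Continuous.subtype_mk (continuous_pi fun w => ?_) _
    by_cases hw : ∃ v, ι v = w
    · obtain ⟨v, rfl⟩ := hw
      simp only [ι.injective.extend_apply]
      exact (continuous_apply (A := fun _ => ℝ) v).comp continuous_subtype_val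
    · simpa only [extend_apply' _ _ _ hw] using continuous_const

lemma isCompact_realization (hL : L.Finite) : IsCompact (realization L) := by
  have : realization L =
      ⋃ σ ∈ L, {f | (∀ w, 0 ≤ f w) ∧ (∀ w ∉ σ, f w = 0) ∧ ∑ w ∈ σ, f w = 1} := by
    ext f
    simp only [realization, Set.mem_iUnion, exists_prop, Set.mem_ofPred_eq]
    constructor
    · rintro ⟨h0, σ, hσ, h1, h2⟩
      exact ⟨σ, hσ, h0, fun w => eq_zero_of_support_subset h1, h2⟩
    · rintro ⟨σ, hσ, h0, h1, h2⟩
      exact ⟨h0, σ, hσ, fun w hw => by_contra fun h => hw (h1 w h), h2⟩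
  rw [this]
  refine hL.isCompact_biUnion fun σ _ => ?_
  refine (isCompact_univ_pi fun _ : W => isCompact_Icc (a := (0 : ℝ)) (b := 1)).of_isClosed_subset
    ?_ ?_
  · simp only [Set.ofPred_and, Set.ofPred_forall]
    refine IsClosed.inter (isClosed_iInter fun w => isClosed_le continuous_const
      (continuous_apply w)) (IsClosed.inter (isClosed_iInter fun w => isClosed_iInter fun _ =>
        isClosed_eq (continuous_apply w) continuous_const) (isClosed_eq
          (continuous_finsetSum _ fun w _ => continuous_apply w) continuous_const))
  · rintro f ⟨h0, h1, h2⟩ w -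
    refine ⟨h0 w, ?_⟩
    by_cases hw : w ∈ σ
    · exact (Finset.single_le_sum (fun i _ => h0 i) hw).trans h2.le
    · exact (h1 w hw).trans_le zero_le_one

variable [DecidableEq W]

lemma continuous_shiftWeight (hα : α.Nonempty) (m : W) :
    Continuous fun p : ℝ × (W → ℝ) => shiftWeight hα m p.1 p.2 := by
  refine continuous_pi fun w => ?_
  have : Continuous fun p : ℝ × (W → ℝ) => α.inf' hα p.2 :=
    Continuous.finset_inf'_apply hα fun i _ => (continuous_apply i).comp continuous_snd
  unfold shiftWeight
  fun_prop

lemma shiftWeight_zero (hα : α.Nonempty) : shiftWeight hα m 0 f = f := by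
  funext w
  simp [shiftWeight]

lemma shiftWeight_eq_self (hα : α.Nonempty) (hf : ∀ w, 0 ≤ f w) {v : W} (hv : v ∈ α)
    (hfv : f v = 0) (t : ℝ) : shiftWeight hα m t f = f := by
  have h : α.inf' hα f = 0 :=
    le_antisymm ((Finset.inf'_le f hv).trans hfv.le) (Finset.le_inf' _ _ fun w _ => hf w)
  funext w
  simp [shiftWeight, h]

lemma exists_shiftWeight_one_eq_zero (hα : α.Nonempty) (hm : m ∉ α) (f : W → ℝ) :
    ∃ v ∈ α, shiftWeight hα m 1 f v = 0 := by
  obtain ⟨v, hv, h⟩ := Finset.exists_mem_eq_inf' hα f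
  refine ⟨v, hv, ?_⟩
  have : v ≠ m := fun h => hm (h ▸ hv)
  simp [shiftWeight, h, hv, this]

lemma shiftWeight_mem_realization (hα : α.Nonempty) (hm : m ∉ α)
    (h : ∀ σ ∈ L, α ⊆ σ → insert m σ ∈ L) (hf : f ∈ realization L) {t : ℝ} (ht : t ∈ unitInterval) :
    shiftWeight hα m t f ∈ realization L := by
  obtain ⟨hf0, σ, hσ, hsupp, hsum⟩ := hf
  by_cases hασ : α ⊆ σ
  swap
  · obtain ⟨v, hv, hvσ⟩ := Finset.not_subset.1 hασ
    rw [shiftWeight_eq_self hα hf0 hv (eq_zero_of_support_subset hsupp hvσ)]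
    exact ⟨hf0, σ, hσ, hsupp, hsum⟩
  have hs : 0 ≤ α.inf' hα f := Finset.le_inf' _ _ fun w _ => hf0 w
  refine ⟨fun w => ?_, insert m σ, h σ hσ hασ, fun w hw => ?_, ?_⟩
  · by_cases hw : w ∈ α
    · have hwm : w ≠ m := fun h => hm (h ▸ hw)
      have h1 : α.inf' hα f ≤ f w := Finset.inf'_le f hw
      have h2 : t * α.inf' hα f ≤ α.inf' hα f := mul_le_of_le_one_left hs ht.2
      simp only [shiftWeight, hw, hwm, if_true, if_false]
      linarith
    · simp only [shiftWeight, hw, if_false, sub_zero]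
      have : (0 : ℝ) ≤ if w = m then (α.card : ℝ) else 0 := by positivity
      have := mul_nonneg (mul_nonneg ht.1 hs) this
      linarith [hf0 w]
  · by_contra hwm
    simp only [Finset.coe_insert, Set.mem_insert_iff, Finset.mem_coe, not_or] at hwm
    have hwα : w ∉ α := fun h => hwm.2 (hασ h)
    exact hw (by simp [shiftWeight, hwm.1, hwα, eq_zero_of_support_subset hsupp hwm.2])
  · have hsum' : ∑ w ∈ insert m σ, f w = 1 := by
      rw [Finset.sum_insert_of_eq_zero_if_notMem, hsum]
      exact fun hmσ => eq_zero_of_support_subset hsupp hmσ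
    have hinter : insert m σ ∩ α = α :=
      Finset.inter_eq_right.2 (hασ.trans (Finset.subset_insert _ _))
    simp [shiftWeight, Finset.sum_add_distrib, ← Finset.mul_sum, Finset.sum_sub_distrib, hsum',
      Finset.sum_ite_mem, hinter]

lemma mem_realization_of_apply_eq_zero (hL : IsLowerSet L) (hf : f ∈ realization L) {v : W}
    (hv : v ∈ α) (hfv : f v = 0) : f ∈ realization {σ ∈ L | ¬ α ⊆ σ} := by
  obtain ⟨hf0, σ, hσ, hsupp, hsum⟩ := hf
  refine ⟨hf0, σ.erase v, ⟨hL (Finset.erase_subset v σ) hσ, fun h => ?_⟩, fun w hw => ?_, ?_⟩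
  · exact Finset.notMem_erase v σ (h hv)
  · have : w ≠ v := fun h => hw (h ▸ hfv)
    simpa [this] using hsupp hw
  · rw [Finset.sum_erase σ hfv, hsum]

/-- Deleting the open star of `α` from a complex does not change the homotopy type of its
realization if the link of `α` is a cone with apex `m`. -/
theorem nonempty_homotopyEquiv_deleteStar (hL : IsLowerSet L) (hα : α.Nonempty) (hm : m ∉ α)
    (h : ∀ σ ∈ L, α ⊆ σ → insert m σ ∈ L) :
    Nonempty (realization {σ ∈ L | ¬ α ⊆ σ} ≃ₕ realization L) := by
  have hmono : realization {σ ∈ L | ¬ α ⊆ σ} ⊆ realization L :=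
    fun f ⟨h0, σ, hσ, h1⟩ => ⟨h0, σ, hσ.1, h1⟩
  have hfix : ∀ f ∈ realization {σ ∈ L | ¬ α ⊆ σ}, shiftWeight hα m 1 f = f := by
    rintro f ⟨hf0, σ, ⟨-, hσ⟩, hsupp, -⟩
    obtain ⟨v, hv, hvσ⟩ := Finset.not_subset.1 hσ
    exact shiftWeight_eq_self hα hf0 hv (eq_zero_of_support_subset hsupp hvσ) 1
  have hret : ∀ f ∈ realization L,
      shiftWeight hα m 1 f ∈ realization {σ ∈ L | ¬ α ⊆ σ} := fun f hf => by
    obtain ⟨v, hv, hfv⟩ := exists_shiftWeight_one_eq_zero hα hm f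
    exact mem_realization_of_apply_eq_zero hL
      (shiftWeight_mem_realization hα hm h hf ⟨zero_le_one, le_rfl⟩) hv hfv
  have hcont := continuous_shiftWeight hα m
  let i : C(realization {σ ∈ L | ¬ α ⊆ σ}, realization L) :=
    ⟨Set.inclusion hmono, continuous_inclusion hmono⟩
  let r : C(realization L, realization {σ ∈ L | ¬ α ⊆ σ}) :=
    ⟨fun f => ⟨shiftWeight hα m 1 f, hret f f.2⟩,
      (hcont.comp (continuous_const.prodMk continuous_subtype_val)).subtype_mk _⟩
  refine ⟨⟨i, r, ?_, ?_⟩⟩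
  · have : r.comp i = ContinuousMap.id _ := by
      ext1 f
      exact Subtype.ext (hfix f f.2)
    rw [this]
  · refine ContinuousMap.Homotopic.symm ⟨⟨⟨fun p => ⟨shiftWeight hα m p.1 p.2,
      shiftWeight_mem_realization hα hm h p.2.2 p.1.2⟩, ?_⟩, fun f => ?_, fun f => ?_⟩⟩
    · exact (hcont.comp ((continuous_subtype_val.comp continuous_fst).prodMk
        (continuous_subtype_val.comp continuous_snd))).subtype_mk _
    · exact Subtype.ext (shiftWeight_zero hα)
    · rfl

end Realization

section RelationalJoin

variable {A B : Type*}

/-- The complex of joins `s ⊔ t` of a face `s` of `R` with a face `t` of `K` such that all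
vertices of `s` are related to `t`. -/
def relJoin (R : Set (Finset A)) (K : Set (Finset B)) (S : A → Finset B → Prop) :
    Set (Finset (A ⊕ B)) :=
  {u | u.toLeft ∈ R ∧ u.toRight ∈ K ∧ ∀ x ∈ u.toLeft, S x u.toRight}

variable {R : Set (Finset A)} {K : Set (Finset B)} {S : A → Finset B → Prop}

lemma isLowerSet_relJoin (hR : IsLowerSet R) (hK : IsLowerSet K) (hS : ∀ x, Antitone (S x)) :
    IsLowerSet (relJoin R K S) := fun _ _ huv hv =>
  ⟨hR (Finset.toLeft_monotone huv) hv.1, hK (Finset.toRight_monotone huv) hv.2.1,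
    fun x hx => hS x (Finset.toRight_monotone huv) (hv.2.2 x (Finset.toLeft_monotone huv hx))⟩

lemma relJoin_singleton_empty_left :
    relJoin {∅} K S = Finset.map (Embedding.inr (α := A)) '' K := by
  ext u
  constructor
  · rintro ⟨h1, h2, -⟩
    refine ⟨_, h2, ?_⟩
    rw [← Finset.empty_disjSum, Finset.disjSum_eq_iff]
    exact ⟨h1.symm, rfl⟩
  · rintro ⟨t, ht, rfl⟩
    rw [← Finset.empty_disjSum]
    exact ⟨Finset.toLeft_disjSum, by rwa [Finset.toRight_disjSum], by
      simp only [Finset.toLeft_disjSum, Finset.notMem_empty, false_imp_iff, implies_true]⟩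

lemma relJoin_singleton_empty_right (hS : ∀ s ∈ R, ∀ x ∈ s, S x ∅) :
    relJoin R {∅} S = Finset.map (Embedding.inl (β := B)) '' R := by
  ext u
  constructor
  · rintro ⟨h1, h2, -⟩
    refine ⟨_, h1, ?_⟩
    rw [← Finset.disjSum_empty, Finset.disjSum_eq_iff]
    exact ⟨rfl, h2.symm⟩
  · rintro ⟨s, hs, rfl⟩
    rw [← Finset.disjSum_empty]
    exact ⟨by rwa [Finset.toLeft_disjSum], Finset.toRight_disjSum, by
      simpa only [Finset.toLeft_disjSum, Finset.toRight_disjSum] using hS s hs⟩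

lemma isLowerSet_sdiff_singleton_of_maximal {s : Finset A} (hR : IsLowerSet R)
    (hs : Maximal (· ∈ R) s) : IsLowerSet (R \ {s}) := fun _ _ hut ht =>
  ⟨hR hut ht.1, fun hu => ht.2 (hs.eq_of_le ht.1 (hu ▸ hut)).symm⟩

lemma exists_maximal_nonempty (hRf : R.Finite) (hne : ¬ R ⊆ {∅}) :
    ∃ s, Maximal (· ∈ R) s ∧ s.Nonempty := by
  obtain ⟨t, ht, htne⟩ := Set.not_subset.1 hne
  obtain ⟨s, hts, hs⟩ := hRf.exists_le_maximal ht
  exact ⟨s, hs, (Finset.nonempty_iff_ne_empty.2 htne).mono hts⟩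

variable [DecidableEq A] [DecidableEq B]

/-- If for every nonempty face `s` of `R` the faces of `K` related to `s` form a cone, then the
relational join retracts to `K`. -/
theorem nonempty_homotopyEquiv_relJoin_left (hRf : R.Finite) (hR : IsLowerSet R) (hR0 : ∅ ∈ R)
    (hK : IsLowerSet K) (hS : ∀ x, Antitone (S x))
    (hcone : ∀ s ∈ R, s.Nonempty → ∃ v, ∀ t ∈ K, (∀ x ∈ s, S x t) →
      insert v t ∈ K ∧ ∀ x ∈ s, S x (insert v t)) :
    Nonempty (realization (relJoin R K S) ≃ₕ realization K) := by
  induction hn : R.ncard generalizing R with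
  | zero => simp [(Set.ncard_eq_zero hRf).1 hn] at hR0
  | succ n ih =>
    by_cases hne : R ⊆ {∅}
    · rw [hne.antisymm (by simpa using hR0), relJoin_singleton_empty_left]
      exact nonempty_homotopyEquiv_of_injective _ _
    obtain ⟨s, hs, hsne⟩ := exists_maximal_nonempty hRf hne
    obtain ⟨v, hv⟩ := hcone s hs.prop hsne
    obtain ⟨e⟩ := ih (hRf.sdiff (t := {s})) (isLowerSet_sdiff_singleton_of_maximal hR hs)
      ⟨hR0, fun h => hsne.ne_empty h.symm⟩ (fun t ht => hcone t ht.1)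
      (by rw [Set.ncard_sdiff_singleton_of_mem hs.prop, hn, Nat.add_sub_cancel])
    have hdel : {u ∈ relJoin R K S | ¬ s.map Embedding.inl ⊆ u} = relJoin (R \ {s}) K S := by
      ext u
      simp only [relJoin, Set.mem_ofPred_eq, Finset.map_inl_subset_iff_subset_toLeft,
        Set.mem_sdiff, Set.mem_singleton_iff]
      have : u.toLeft ∈ R → (s ⊆ u.toLeft ↔ u.toLeft = s) := fun hu =>
        ⟨fun h => (hs.eq_of_le hu h).symm, fun h => h.ge⟩
      tauto
    obtain ⟨e'⟩ := nonempty_homotopyEquiv_deleteStar (isLowerSet_relJoin hR hK hS)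
      (α := s.map Embedding.inl) (m := Sum.inr v) (by simpa using hsne) (by simp) (by
        rintro u ⟨h1, h2, h3⟩ hsu
        rw [Finset.map_inl_subset_iff_subset_toLeft] at hsu
        have hus := hs.eq_of_le h1 hsu
        rw [← hus] at h3
        refine ⟨by simpa [← hus] using hs.prop, by simpa using (hv _ h2 h3).1, ?_⟩
        simpa only [Finset.toLeft_insert_inr, Finset.toRight_insert_inr, ← hus] using
          (hv _ h2 h3).2)
    rw [hdel] at e'
    exact ⟨e'.symm.trans e⟩

/-- A vertex set `Y` is dismantlable in `R` if it reduces to a single vertex of `R` by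
successively deleting a vertex `x` dominated by another one `m`. -/
inductive Dismantlable (R : Set (Finset A)) : Finset A → Prop
  | singleton (x : A) : {x} ∈ R → Dismantlable R {x}
  | erase (Y : Finset A) (x m : A) : m ∈ Y → m ≠ x →
      (∀ s ∈ R, s ⊆ Y → x ∈ s → insert m s ∈ R) →
      Dismantlable R (Y.erase x) → Dismantlable R Y

lemma Dismantlable.nonempty_homotopyEquiv {t : Finset B} {Y : Finset A} (hY : Dismantlable R Y)
    (hR : IsLowerSet R) (hK : IsLowerSet K) (hS : ∀ x, Antitone (S x))
    (ht : Maximal (· ∈ K) t) (htne : t.Nonempty) (hYS : ∀ x ∈ Y, S x t) :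
    Nonempty (realization {u ∈ relJoin R K S | u.toRight = t → u.toLeft ⊆ Y} ≃ₕ
      realization (relJoin R (K \ {t}) S)) := by
  have hmax : ∀ u ∈ K, (t ⊆ u ↔ u = t) := fun u hu =>
    ⟨fun h => (ht.eq_of_le hu h).symm, fun h => h.ge⟩
  have hlow : ∀ Y : Finset A,
      IsLowerSet {u ∈ relJoin R K S | u.toRight = t → u.toLeft ⊆ Y} := fun Y u v hvu hu =>
    ⟨isLowerSet_relJoin hR hK hS hvu hu.1, fun hv => (Finset.toLeft_monotone hvu).trans
      (hu.2 ((hmax _ hu.1.2.1).1 (hv ▸ Finset.toRight_monotone hvu)))⟩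
  induction hY with
  | singleton x hx =>
    have hdel : {u ∈ {u ∈ relJoin R K S | u.toRight = t → u.toLeft ⊆ {x}} |
        ¬ t.map Embedding.inr ⊆ u} = relJoin R (K \ {t}) S := by
      ext u
      simp only [relJoin, Set.mem_ofPred_eq, Finset.map_inr_subset_iff_subset_toRight,
        Set.mem_sdiff, Set.mem_singleton_iff]
      have := hmax u.toRight
      tauto
    rw [← hdel]
    obtain ⟨e⟩ := nonempty_homotopyEquiv_deleteStar (hlow {x})
      (α := t.map Embedding.inr) (m := Sum.inl x) (by simpa using htne) (by simp) (by
        rintro u ⟨⟨h1, h2, h3⟩, h4⟩ htu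
        rw [Finset.map_inr_subset_iff_subset_toRight, hmax _ h2] at htu
        have hins : insert x u.toLeft = {x} :=
          Finset.Subset.antisymm (Finset.insert_subset (by simp) (h4 htu)) (by simp)
        rw [htu] at h3
        simpa [relJoin, hins, htu, hx, ht.prop, hYS x] using h3)
    exact ⟨e.symm⟩
  | erase Y x m hm hmx hdom _ ih =>
    obtain ⟨e⟩ := ih fun y hy => hYS y (Finset.mem_of_mem_erase hy)
    have hdel : {u ∈ {u ∈ relJoin R K S | u.toRight = t → u.toLeft ⊆ Y} |
        ¬ ({x} : Finset A).disjSum t ⊆ u} =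
        {u ∈ relJoin R K S | u.toRight = t → u.toLeft ⊆ Y.erase x} := by
      ext u
      simp only [relJoin, Set.mem_ofPred_eq, Finset.disjSum_subset, Finset.singleton_subset_iff,
        Finset.subset_erase]
      have := hmax u.toRight
      tauto
    obtain ⟨e'⟩ := nonempty_homotopyEquiv_deleteStar (hlow Y)
      (α := ({x} : Finset A).disjSum t) (m := Sum.inl m) ⟨Sum.inl x, by simp⟩ (by simpa using hmx)
      (by
        rintro u ⟨⟨h1, h2, h3⟩, h4⟩ htu
        rw [Finset.disjSum_subset, Finset.singleton_subset_iff, hmax _ h2] at htu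
        have hins := hdom _ h1 (h4 htu.2) htu.1
        rw [htu.2] at h3
        simpa [relJoin, hins, htu.2, ht.prop, Finset.insert_subset_iff, hm, h4 htu.2, hYS m hm]
          using h3)
    rw [hdel] at e'
    exact ⟨e'.symm.trans e⟩

/-- If for every nonempty face `t` of `K` the vertices related to `t` are dismantlable, then the
relational join retracts to `R`. -/
theorem nonempty_homotopyEquiv_relJoin_right (hR : IsLowerSet R) (hKf : K.Finite)
    (hK : IsLowerSet K) (hK0 : ∅ ∈ K) (hS : ∀ x, Antitone (S x))
    (hS0 : ∀ s ∈ R, ∀ x ∈ s, S x ∅)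
    (hdis : ∀ t ∈ K, t.Nonempty → ∃ Y : Finset A, Dismantlable R Y ∧ (∀ x ∈ Y, S x t) ∧
      ∀ s ∈ R, (∀ x ∈ s, S x t) → s ⊆ Y) :
    Nonempty (realization (relJoin R K S) ≃ₕ realization R) := by
  induction hn : K.ncard generalizing K with
  | zero => simp [(Set.ncard_eq_zero hKf).1 hn] at hK0
  | succ n ih =>
    by_cases hne : K ⊆ {∅}
    · rw [hne.antisymm (by simpa using hK0), relJoin_singleton_empty_right hS0]
      exact nonempty_homotopyEquiv_of_injective _ _
    obtain ⟨t, ht, htne⟩ := exists_maximal_nonempty hKf hne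
    obtain ⟨Y, hY, hYS, hRY⟩ := hdis t ht.prop htne
    obtain ⟨e⟩ := ih (hKf.sdiff (t := {t})) (isLowerSet_sdiff_singleton_of_maximal hK ht)
      ⟨hK0, fun h => htne.ne_empty h.symm⟩ (fun t ht => hdis t ht.1)
      (by rw [Set.ncard_sdiff_singleton_of_mem ht.prop, hn, Nat.add_sub_cancel])
    obtain ⟨e'⟩ := hY.nonempty_homotopyEquiv hR hK hS ht htne hYS
    have hfull : {u ∈ relJoin R K S | u.toRight = t → u.toLeft ⊆ Y} = relJoin R K S :=
      Set.sep_eq_self_iff_mem_true.2 fun u hu hut => hRY _ hu.1 (hut ▸ hu.2.2)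
    rw [hfull] at e'
    exact ⟨e'.trans e⟩

end RelationalJoin

section Rips

variable {M : Type*} [PseudoMetricSpace M]

/-- The faces of the Rips complex, including the empty one. -/
def ripsFaces (X : Set M) (ε : ℝ) : Set (Finset M) :=
  {s | ↑s ⊆ X ∧ ∀ x ∈ s, ∀ y ∈ s, dist x y < ε}

lemma isLowerSet_ripsFaces (X : Set M) (ε : ℝ) : IsLowerSet (ripsFaces X ε) :=
  fun _ _ hts hs => ⟨(Finset.coe_subset.2 hts).trans hs.1,
    fun x hx y hy => hs.2 x (hts hx) y (hts hy)⟩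

lemma finite_ripsFaces {X : Set M} (hX : X.Finite) (ε : ℝ) : (ripsFaces X ε).Finite :=
  hX.toFinset.powerset.finite_toSet.subset fun s hs => by
    simpa [Set.Finite.subset_toFinset] using hs.1

lemma diam_coe_finset_lt {s : Finset M} {ε : ℝ} (hε : 0 < ε)
    (h : ∀ x ∈ s, ∀ y ∈ s, dist x y < ε) : diam (s : Set M) < ε := by
  rcases s.eq_empty_or_nonempty with rfl | hs
  · simpa using hε
  · obtain ⟨⟨x, y⟩, hxy, hmax⟩ := Finset.exists_max_image (s ×ˢ s) (fun p => dist p.1 p.2)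
      (hs.product hs)
    rw [Finset.mem_product] at hxy
    exact (diam_le_of_forall_dist_le dist_nonneg fun a ha b hb =>
      hmax (a, b) (Finset.mem_product.2 ⟨ha, hb⟩)).trans_lt (h x hxy.1 y hxy.2)

end Rips

lemma ripsRealization_eq {n : ℕ} (X : Set (EuclideanSpace ℝ (Fin n))) {ε : ℝ} (hε : 0 < ε) :
    ripsRealization X ε = realization (ripsFaces X ε) := by
  ext f
  constructor
  · rintro ⟨hf0, hfin, hX, hdiam, hsum⟩
    refine ⟨hf0, hfin.toFinset, ⟨by simpa using hX, fun x hx y hy => ?_⟩, by simp, ?_⟩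
    · exact (dist_le_diam_of_mem hfin.isBounded (hfin.mem_toFinset.1 hx)
        (hfin.mem_toFinset.1 hy)).trans_lt hdiam
    · rw [← hsum, finsum_eq_sum f hfin]
  · rintro ⟨hf0, σ, ⟨hσX, hσ⟩, hsupp, hsum⟩
    refine ⟨hf0, σ.finite_toSet.subset hsupp, hsupp.trans hσX, ?_, ?_⟩
    · exact (diam_mono hsupp σ.finite_toSet.isBounded).trans_lt (diam_coe_finset_lt hε hσ)
    · rw [finsum_eq_sum_of_support_subset f hsupp, hsum]

section Polyhedron

open Geometry

variable {E : Type*} [NormedAddCommGroup E] [InnerProductSpace ℝ E]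
  {K : SimplicialComplex ℝ E} {s t : Finset E}

lemma weights_unique (hs : s ∈ K.faces) {w w' : E → ℝ} (hsum : ∑ v ∈ s, w v = ∑ v ∈ s, w' v)
    (hsmul : ∑ v ∈ s, w v • v = ∑ v ∈ s, w' v • v) : ∀ v ∈ s, w v = w' v := by
  intro v hv
  have h := (affineIndependent_iff.1 (K.indep hs)) Finset.univ (fun v => w v - w' v)
    (by
      rw [Finset.sum_coe_sort s fun v => w v - w' v, Finset.sum_sub_distrib, hsum, sub_self])
    (by
      simp only [sub_smul]
      rw [Finset.sum_coe_sort s fun v => w v • v - w' v • v, Finset.sum_sub_distrib, hsmul,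
        sub_self])
    ⟨v, hv⟩ (Finset.mem_univ _)
  exact sub_eq_zero.1 h

lemma weight_eq_zero (hs : s ∈ K.faces) (ht : t ∈ K.faces) {w : E → ℝ}
    (hw0 : ∀ v ∈ s, 0 ≤ w v) (hw1 : ∑ v ∈ s, w v = 1)
    (hp : ∑ v ∈ s, w v • v ∈ convexHull ℝ (t : Set E)) {v : E} (hv : v ∈ s) (hvt : v ∉ t) :
    w v = 0 := by
  classical
  have hps : ∑ v ∈ s, w v • v ∈ convexHull ℝ (s : Set E) :=
    Finset.mem_convexHull'.2 ⟨w, hw0, hw1, rfl⟩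
  have hpi := K.inter_subset_convexHull hs ht ⟨hps, hp⟩
  rw [← Finset.coe_inter, Finset.mem_convexHull'] at hpi
  obtain ⟨u, -, hu1, hup⟩ := hpi
  have h := weights_unique hs (w := w) (w' := fun v => if v ∈ t then u v else 0)
    (by rw [hw1, ← hu1, ← Finset.sum_filter, Finset.filter_mem_eq_inter])
    (by
      rw [← hup]
      simp only [ite_smul, zero_smul]
      rw [← Finset.sum_filter, Finset.filter_mem_eq_inter])
    v hv
  simpa [hvt] using h

lemma isCompact_space (hK : K.faces.Finite) : IsCompact K.space :=
  hK.isCompact_biUnion fun s _ => s.finite_toSet.isCompact_convexHull ℝ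

/-- The realization of the abstract simplicial complex underlying `K` is homeomorphic to the
polyhedron of `K`. -/
theorem nonempty_homotopyEquiv_space (hK : K.faces.Finite) :
    Nonempty (realization (insert ∅ K.faces) ≃ₕ K.space) := by
  classical
  set V : Finset E := hK.toFinset.biUnion id with hV
  have hsub : ∀ s ∈ K.faces, s ⊆ V := fun s hs v hv =>
    Finset.mem_biUnion.2 ⟨s, hK.mem_toFinset.2 hs, hv⟩
  have hface : ∀ f ∈ realization (insert ∅ K.faces), ∃ s ∈ K.faces, support f ⊆ s ∧
      ∑ v ∈ s, f v = 1 ∧ ∑ v ∈ V, f v • v = ∑ v ∈ s, f v • v := by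
    rintro f ⟨-, s, rfl | hs, hsupp, hsum⟩
    · simp at hsum
    · refine ⟨s, hs, hsupp, hsum, (Finset.sum_subset (hsub s hs) fun v _ hv => ?_).symm⟩
      rw [eq_zero_of_support_subset hsupp hv, zero_smul]
  have hmem : ∀ f ∈ realization (insert ∅ K.faces), ∑ v ∈ V, f v • v ∈ K.space := fun f hf => by
    obtain ⟨s, hs, -, hsum, heq⟩ := hface f hf
    rw [heq]
    exact SimplicialComplex.convexHull_subset_space hs
      (Finset.mem_convexHull'.2 ⟨f, fun v _ => hf.1 v, hsum, rfl⟩)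
  let Φ : realization (insert ∅ K.faces) → K.space := fun f => ⟨∑ v ∈ V, f.1 v • v, hmem f f.2⟩
  have hcont : Continuous Φ := by
    have h : Continuous fun f : E → ℝ => ∑ v ∈ V, f v • v := by fun_prop
    exact (h.comp continuous_subtype_val).subtype_mk _
  have hinj : Injective Φ := by
    rintro ⟨f, hf⟩ ⟨g, hg⟩ hfg
    have hfg' : ∑ v ∈ V, f v • v = ∑ v ∈ V, g v • v := congrArg Subtype.val hfg
    obtain ⟨s, hs, hsf, hsumf, heqf⟩ := hface f hf
    obtain ⟨t, ht, htg, hsumg, heqg⟩ := hface g hg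
    have hg0 : ∀ v ∉ s, g v = 0 := fun v hvs => by
      by_cases hvt : v ∈ t
      · refine weight_eq_zero ht hs (fun v _ => hg.1 v) hsumg ?_ hvt hvs
        rw [← heqg, ← hfg', heqf]
        exact Finset.mem_convexHull'.2 ⟨f, fun v _ => hf.1 v, hsumf, rfl⟩
      · exact eq_zero_of_support_subset htg hvt
    have hsumg' : ∑ v ∈ s, g v = 1 := by
      rw [← hsumg]
      trans ∑ v ∈ s ∪ t, g v
      · exact Finset.sum_subset Finset.subset_union_left fun v _ hv => hg0 v hv
      · exact (Finset.sum_subset Finset.subset_union_right fun v _ hv =>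
          eq_zero_of_support_subset htg hv).symm
    have heqg' : ∑ v ∈ V, g v • v = ∑ v ∈ s, g v • v :=
      (Finset.sum_subset (hsub s hs) fun v _ hv => by rw [hg0 v hv, zero_smul]).symm
    have h := weights_unique hs (hsumf.trans hsumg'.symm) (by rw [← heqf, ← heqg', hfg'])
    refine Subtype.ext (funext fun v => ?_)
    by_cases hv : v ∈ s
    · exact h v hv
    · exact (eq_zero_of_support_subset hsf hv).trans (hg0 v hv).symm
  have hsurj : Surjective Φ := by
    rintro ⟨p, hp⟩
    obtain ⟨s, hs, hps⟩ := SimplicialComplex.mem_space_iff.1 hp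
    obtain ⟨w, hw0, hw1, hwp⟩ := Finset.mem_convexHull'.1 hps
    refine ⟨⟨fun v => if v ∈ s then w v else 0, fun v => ?_, s, Or.inr hs, fun v hv => ?_, ?_⟩,
      Subtype.ext ?_⟩
    · dsimp only
      split_ifs with hv
      exacts [hw0 v hv, le_rfl]
    · by_contra h
      exact hv (if_neg h)
    · rw [← hw1]
      exact Finset.sum_congr rfl fun v hv => if_pos hv
    · change ∑ v ∈ V, (if v ∈ s then w v else 0) • v = p
      simp only [ite_smul, zero_smul]
      rw [← Finset.sum_filter, Finset.filter_mem_eq_inter, Finset.inter_eq_right.2 (hsub s hs),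
        hwp]
  have : CompactSpace (realization (insert ∅ K.faces)) :=
    isCompact_iff_compactSpace.1 (isCompact_realization (hK.insert ∅))
  exact ⟨(Continuous.homeoOfEquivCompactToT2
    (f := Equiv.ofBijective Φ ⟨hinj, hsurj⟩) hcont).toHomotopyEquiv⟩

/-- The open star of `t` in the polyhedron of `K`. -/
def openStar (K : SimplicialComplex ℝ E) (t : Finset E) : Set E :=
  {p ∈ K.space | ∀ s ∈ K.faces, p ∈ convexHull ℝ (s : Set E) → t ⊆ s}

lemma antitone_openStar (x : E) : Antitone fun t => x ∈ openStar K t :=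
  fun _ _ htt' hx => ⟨hx.1, fun s hs hxs => htt'.trans (hx.2 s hs hxs)⟩

/-- The barycenter of a finite set. -/
noncomputable def barycenter (t : Finset E) : E := ∑ v ∈ t, (t.card : ℝ)⁻¹ • v

/-- Points on a segment from a point of a face containing `t` to the barycenter of `t` lie in
the open star of `t`. -/
lemma lineMap_barycenter_mem_openStar (hs : s ∈ K.faces) (ht : t.Nonempty) (hts : t ⊆ s) {x : E}
    (hx : x ∈ convexHull ℝ (s : Set E)) {c : ℝ} (hc0 : 0 < c) (hc1 : c ≤ 1) :
    AffineMap.lineMap x (barycenter t) c ∈ openStar K t := by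
  classical
  obtain ⟨w, hw0, hw1, hwx⟩ := Finset.mem_convexHull'.1 hx
  have hcard : (0 : ℝ) < t.card := by exact_mod_cast ht.card_pos
  set u : E → ℝ := fun v => (1 - c) * w v + c * if v ∈ t then (t.card : ℝ)⁻¹ else 0 with hu
  have hut : ∀ g : E → ℝ, (∑ v ∈ s, if v ∈ t then g v else 0) = ∑ v ∈ t, g v := fun g => by
    rw [← Finset.sum_filter, Finset.filter_mem_eq_inter, Finset.inter_eq_right.2 hts]
  have hu0 : ∀ v ∈ s, 0 ≤ u v := fun v hv => by
    have : (0 : ℝ) ≤ if v ∈ t then (t.card : ℝ)⁻¹ else 0 := by positivity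
    have := hw0 v hv
    have : 0 ≤ 1 - c := by linarith
    positivity
  have hu1 : ∑ v ∈ s, u v = 1 := by
    simp only [hu, Finset.sum_add_distrib, ← Finset.mul_sum, hw1]
    rw [hut fun _ => (t.card : ℝ)⁻¹, Finset.sum_const, nsmul_eq_mul, mul_inv_cancel₀ hcard.ne']
    ring
  have hup : AffineMap.lineMap x (barycenter t) c = ∑ v ∈ s, u v • v := by
    simp only [hu, add_smul, mul_smul, Finset.sum_add_distrib, ← Finset.smul_sum, hwx, ite_smul,
      zero_smul]
    rw [← Finset.sum_filter, Finset.filter_mem_eq_inter, Finset.inter_eq_right.2 hts,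
      AffineMap.lineMap_apply_module, barycenter]
  rw [hup]
  refine ⟨SimplicialComplex.convexHull_subset_space hs
    (Finset.mem_convexHull'.2 ⟨u, hu0, hu1, rfl⟩), fun s' hs' hp v hv => by_contra fun hvs' => ?_⟩
  have h := weight_eq_zero hs hs' hu0 hu1 hp (hts hv) hvs'
  have h1 := mul_nonneg (sub_nonneg.2 hc1) (hw0 v (hts hv))
  have h2 := mul_pos hc0 (inv_pos.2 hcard)
  simp only [hu, hv, if_true] at h
  linarith

lemma exists_vertex_forall_mem (hK : K.faces.Finite) {p : E} (hp : p ∈ K.space) :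
    ∃ v, ∀ s ∈ K.faces, p ∈ convexHull ℝ (s : Set E) → v ∈ s := by
  classical
  obtain ⟨s, ⟨hs, hps⟩, hmin⟩ := (hK.subset (Set.sep_subset K.faces fun s : Finset E =>
    p ∈ convexHull ℝ (s : Set E))).exists_minimal (SimplicialComplex.mem_space_iff.1 hp)
  obtain ⟨v, hv⟩ := SimplicialComplex.nonempty_of_mem_faces hs
  refine ⟨v, fun t ht hpt => ?_⟩
  have hpi := K.inter_subset_convexHull hs ht ⟨hps, hpt⟩
  rw [← Finset.coe_inter] at hpi
  have hne : (s ∩ t).Nonempty := by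
    simpa only [Finset.coe_nonempty] using convexHull_nonempty_iff.1 ⟨p, hpi⟩
  exact Finset.mem_of_mem_inter_right
    (hmin ⟨K.down_closed hs Finset.inter_subset_left hne, hpi⟩ Finset.inter_subset_left hv)

/-- Sufficiently small subsets of the polyhedron lie in the open star of a vertex. -/
lemma exists_forall_mem_openStar (hK : K.faces.Finite) :
    ∃ δ > 0, ∀ x ∈ K.space, ∃ v, ∀ y ∈ K.space, dist y x < δ → y ∈ openStar K {v} := by
  obtain ⟨δ, hδ, h⟩ := lebesgue_number_lemma_of_metric (isCompact_space hK)
    (c := fun v : E => (⋃ s ∈ {s ∈ K.faces | v ∉ s}, convexHull ℝ (s : Set E))ᶜ)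
    (fun v => ((hK.subset (Set.sep_subset _ _)).isClosed_biUnion fun s _ =>
      s.finite_toSet.isClosed_convexHull ℝ).isOpen_compl) fun p hp => by
        obtain ⟨v, hv⟩ := exists_vertex_forall_mem hK hp
        refine Set.mem_iUnion.2 ⟨v, fun hmem => ?_⟩
        obtain ⟨s, ⟨hs, hvs⟩, hps⟩ := Set.mem_iUnion₂.1 hmem
        exact hvs (hv s hs hps)
  refine ⟨δ, hδ, fun x hx => ?_⟩
  obtain ⟨v, hv⟩ := h x hx
  refine ⟨v, fun y hy hyx => ⟨hy, fun s hs hys => ?_⟩⟩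
  by_contra hvs
  exact hv hyx (Set.mem_iUnion₂.2 ⟨s, ⟨hs, by simpa using hvs⟩, hys⟩)

lemma dist_lineMap_le {b x z : E} {ε D c : ℝ} (hε : 0 < ε) (hD : ε ≤ D)
    (hc : c = ε ^ 2 / (2 * D ^ 2)) (hz : dist z b ≤ dist x b) (hx : dist x b ≤ D)
    (hxz : dist x z < ε) : dist (AffineMap.lineMap x b c) z ≤ ε * (1 - c / 4) := by
  have hD0 : 0 < D := hε.trans_le hD
  have hcD : c * D ^ 2 = ε ^ 2 / 2 := by rw [hc]; field_simp
  have hc0 : 0 < c := by rw [hc]; positivity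
  have hc1 : c ≤ 1 := by nlinarith
  have hp : AffineMap.lineMap x b c - z = (x - z) - c • (x - b) := by
    rw [AffineMap.lineMap_apply_module]
    module
  have hzb : z - b = (x - b) - (x - z) := by abel
  rw [dist_eq_norm] at *
  rw [dist_eq_norm] at *
  have h1 : ‖z - b‖ ^ 2 = ‖x - b‖ ^ 2 - 2 * inner ℝ (x - b) (x - z) + ‖x - z‖ ^ 2 := by
    rw [hzb, norm_sub_sq_real]
  have h2 : ‖AffineMap.lineMap x b c - z‖ ^ 2 =
      ‖x - z‖ ^ 2 - 2 * (c * inner ℝ (x - b) (x - z)) + c ^ 2 * ‖x - b‖ ^ 2 := by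
    rw [hp, norm_sub_sq_real, inner_smul_right, norm_smul, mul_pow, Real.norm_eq_abs, sq_abs,
      real_inner_comm]
  have h3 : ‖z - b‖ ^ 2 ≤ ‖x - b‖ ^ 2 := by gcongr
  have h4 : ‖x - z‖ ^ 2 ≤ ε ^ 2 := by gcongr
  have h5 : c ^ 2 * ‖x - b‖ ^ 2 ≤ c * (ε ^ 2 / 2) := by
    rw [← hcD, sq c, mul_assoc]
    gcongr
  refine le_of_sq_le_sq ?_ (by nlinarith)
  have h6 : c * ‖x - z‖ ^ 2 ≤ 2 * (c * inner ℝ (x - b) (x - z)) := by nlinarith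
  have h7 : (1 - c) * ‖x - z‖ ^ 2 ≤ (1 - c) * ε ^ 2 := by gcongr
  nlinarith [sq_nonneg (c * ε)]


/-- A set of points that contains `b` and is dense enough to approximate a small radial
contraction towards `b` is dismantlable in the Rips complex, by removing points in order of
decreasing distance from `b`. -/
lemma dismantlable_ripsFaces [DecidableEq E] {X : Set E} {b : E} {ε D c : ℝ} (hε : 0 < ε)
    (hD : ε ≤ D) (hc : c = ε ^ 2 / (2 * D ^ 2)) {Y' : Finset E} (hX : ↑Y' ⊆ X)
    (hbD : ∀ x ∈ Y', dist x b ≤ D)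
    (hdense : ∀ x ∈ Y', ∃ m ∈ Y', dist m (AffineMap.lineMap x b c) < c * ε / 4)
    (Y : Finset E) (hY : Y ⊆ Y') (hb : b ∈ Y)
    (hrad : ∀ z ∈ Y', ∀ y ∈ Y, dist z b < dist y b → z ∈ Y) :
    Dismantlable (ripsFaces X ε) Y := by
  have hD0 : 0 < D := hε.trans_le hD
  have hc0 : 0 < c := by rw [hc]; positivity
  have hc1 : c ≤ 1 := by
    rw [hc, div_le_one (by positivity)]
    nlinarith
  induction Y using Finset.strongInduction with
  | H Y ih =>
  by_cases hYb : Y = {b}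
  · subst hYb
    refine Dismantlable.singleton b ⟨fun y hy => hX (hY hy), ?_⟩
    simpa using hε
  obtain ⟨y, hy, hyb⟩ : ∃ y ∈ Y, y ≠ b := by
    by_contra! h
    exact hYb (Finset.eq_singleton_iff_unique_mem.2 ⟨hb, h⟩)
  obtain ⟨x, hx, hmax⟩ := Finset.exists_max_image Y (fun z => dist z b) ⟨b, hb⟩
  have hxb : b ≠ x := by
    rintro rfl
    have h := hmax y hy
    rw [dist_self] at h
    exact absurd h (dist_pos.2 hyb).not_ge
  obtain ⟨m, hm, hmx, hdom⟩ : ∃ m ∈ Y, m ≠ x ∧ ∀ z ∈ Y, dist x z < ε → dist m z < ε := by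
    rcases lt_or_ge (dist x b) ε with hlt | hge
    · exact ⟨b, hb, hxb, fun z hz _ => by rw [dist_comm]; exact (hmax z hz).trans_lt hlt⟩
    · obtain ⟨m, hm, hmp⟩ := hdense x (hY hx)
      have hmb : dist m b < dist x b := by
        have h1 := dist_triangle m (AffineMap.lineMap x b c) b
        rw [dist_lineMap_right, Real.norm_of_nonneg (by linarith)] at h1
        nlinarith
      refine ⟨m, hrad m hm x hx hmb, fun h => hmb.ne (by rw [h]), fun z hz hxz => ?_⟩
      have h1 := dist_triangle m (AffineMap.lineMap x b c) z
      have h2 := dist_lineMap_le hε hD hc (hmax z hz) (hbD x (hY hx)) hxz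
      linarith
  refine Dismantlable.erase Y x m hm hmx (fun s hs hsY hxs => ?_) (ih _ (Finset.erase_ssubset hx)
    ((Finset.erase_subset _ _).trans hY) (Finset.mem_erase.2 ⟨hxb, hb⟩) fun z hz y hy hzy =>
      Finset.mem_erase.2 ⟨?_, hrad z hz y (Finset.mem_of_mem_erase hy) hzy⟩)
  · have hms : ∀ z ∈ s, dist m z < ε := fun z hz => hdom z (hsY hz) (hs.2 x hxs z hz)
    refine ⟨?_, ?_⟩
    · rw [Finset.coe_insert]
      exact Set.insert_subset (hX (hY hm)) hs.1
    · simp only [Finset.mem_insert]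
      rintro p (rfl | hp) q (rfl | hq)
      · simpa using hε
      · exact hms q hq
      · rw [dist_comm]
        exact hms p hp
      · exact hs.2 p hp q hq
  · rintro rfl
    exact (hmax y (Finset.mem_of_mem_erase hy)).not_gt hzy

lemma barycenter_mem_openStar (ht : t ∈ K.faces) : barycenter t ∈ openStar K t := by
  obtain ⟨v, hv⟩ := K.nonempty_of_mem_faces ht
  simpa using lineMap_barycenter_mem_openStar ht ⟨v, hv⟩ subset_rfl
    (subset_convexHull ℝ _ (Finset.mem_coe.2 hv)) one_pos le_rfl

lemma lineMap_mem_openStar (ht : t.Nonempty) {x : E} (hx : x ∈ openStar K t) {c : ℝ}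
    (hc0 : 0 < c) (hc1 : c ≤ 1) : AffineMap.lineMap x (barycenter t) c ∈ openStar K t := by
  obtain ⟨s, hs, hxs⟩ := SimplicialComplex.mem_space_iff.1 hx.1
  exact lineMap_barycenter_mem_openStar hs ht (hx.2 s hs hxs) hxs hc0 hc1

lemma isLowerSet_insert_empty_faces : IsLowerSet (insert ∅ K.faces) := by
  rintro s t hts (rfl | hs)
  · exact Or.inl (Finset.subset_empty.1 hts)
  · rcases t.eq_empty_or_nonempty with rfl | ht
    exacts [Or.inl rfl, Or.inr (K.down_closed hs hts ht)]

/-- The polyhedron of a finite simplicial complex contains a finite set that is `η`-dense in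
every open star and contains all barycenters. -/
lemma exists_finite_dense (hK : K.faces.Finite) {η : ℝ} (hη : 0 < η) :
    ∃ X ⊆ K.space, X.Finite ∧ ∀ t ∈ K.faces, barycenter t ∈ X ∧
      ∀ p ∈ openStar K t, ∃ m ∈ X, m ∈ openStar K t ∧ dist m p < η := by
  have hnet : ∀ t, ∃ N ⊆ openStar K t, N.Finite ∧ openStar K t ⊆ ⋃ y ∈ N, ball y η := fun t =>
    finite_approx_of_totallyBounded
      ((isCompact_space hK).totallyBounded.subset fun _ hx => hx.1) η hη
  choose N hN hNfin hcover using hnet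
  refine ⟨⋃ t ∈ K.faces, insert (barycenter t) (N t), ?_,
    hK.biUnion fun t _ => (hNfin t).insert _, fun t ht => ⟨?_, fun p hp => ?_⟩⟩
  · exact Set.iUnion₂_subset fun t ht => Set.insert_subset (barycenter_mem_openStar ht).1
      fun x hx => (hN t hx).1
  · exact Set.mem_biUnion ht (Set.mem_insert _ _)
  · obtain ⟨m, hm, hpm⟩ := Set.mem_iUnion₂.1 (hcover t hp)
    exact ⟨m, Set.mem_biUnion ht (Set.mem_insert_of_mem _ hm), hN t hm, by
      rwa [dist_comm]⟩

theorem exists_ripsFaces_homotopyEquiv_space (hK : K.faces.Finite) :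
    ∃ ε : ℝ, 0 < ε ∧ ∃ X : Set E, X ⊆ K.space ∧ X.Finite ∧
      Nonempty (realization (ripsFaces X ε) ≃ₕ K.space) := by
  classical
  obtain ⟨ε, hε, hstar⟩ := exists_forall_mem_openStar hK
  set D : ℝ := max ε (diam K.space)
  have hD : ε ≤ D := le_max_left _ _
  have hdist : ∀ x ∈ K.space, ∀ y ∈ K.space, dist x y ≤ D := fun x hx y hy =>
    (dist_le_diam_of_mem (isCompact_space hK).isBounded hx hy).trans (le_max_right _ _)
  have hD0 : 0 < D := hε.trans_le hD
  obtain ⟨c, hc⟩ : ∃ c, c = ε ^ 2 / (2 * D ^ 2) := ⟨_, rfl⟩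
  have hc0 : 0 < c := by rw [hc]; positivity
  have hc1 : c ≤ 1 := by
    rw [hc, div_le_one (by positivity)]
    nlinarith
  obtain ⟨X, hXK, hXfin, hX⟩ := exists_finite_dense hK (show 0 < c * ε / 4 by positivity)
  refine ⟨ε, hε, X, hXK, hXfin, ?_⟩
  have hS0 : ∀ s ∈ ripsFaces X ε, ∀ x ∈ s, x ∈ openStar K ∅ := fun s hs x hx =>
    ⟨hXK (hs.1 hx), fun _ _ _ => Finset.empty_subset _⟩
  obtain ⟨e⟩ := nonempty_homotopyEquiv_relJoin_left (R := ripsFaces X ε)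
    (K := insert ∅ K.faces) (S := fun x t => x ∈ openStar K t)
    (finite_ripsFaces hXfin ε) (isLowerSet_ripsFaces X ε) (by simp [ripsFaces])
    isLowerSet_insert_empty_faces antitone_openStar fun s hs ⟨x₀, hx₀⟩ => by
      obtain ⟨v, hv⟩ := hstar x₀ (hXK (hs.1 hx₀))
      have hvs : ∀ x ∈ s, x ∈ openStar K {v} := fun x hx =>
        hv x (hXK (hs.1 hx)) (hs.2 x hx x₀ hx₀)
      have hins : ∀ t, ∀ x ∈ s, x ∈ openStar K t → x ∈ openStar K (insert v t) :=
        fun t x hx hxt => ⟨hxt.1, fun σ hσ hxσ => Finset.insert_subset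
          (Finset.singleton_subset_iff.1 ((hvs x hx).2 σ hσ hxσ)) (hxt.2 σ hσ hxσ)⟩
      refine ⟨v, fun t _ hst => ⟨Or.inr ?_, fun x hx => hins t x hx (hst x hx)⟩⟩
      obtain ⟨σ, hσ, hxσ⟩ := SimplicialComplex.mem_space_iff.1 (hXK (hs.1 hx₀))
      exact K.down_closed hσ ((hins t x₀ hx₀ (hst x₀ hx₀)).2 σ hσ hxσ) (Finset.insert_nonempty _ _)
  obtain ⟨e'⟩ := nonempty_homotopyEquiv_relJoin_right (R := ripsFaces X ε)
    (K := insert ∅ K.faces) (S := fun x t => x ∈ openStar K t) (isLowerSet_ripsFaces X ε)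
    (hK.insert ∅) isLowerSet_insert_empty_faces (Set.mem_insert _ _) antitone_openStar hS0
    fun t ht htne => by
      have ht : t ∈ K.faces := ht.resolve_left htne.ne_empty
      have hmem : ∀ x, x ∈ hXfin.toFinset.filter (· ∈ openStar K t) ↔
        x ∈ X ∧ x ∈ openStar K t := by simp
      refine ⟨hXfin.toFinset.filter (· ∈ openStar K t),
        dismantlable_ripsFaces hε hD hc (b := barycenter t) (fun x hx => ((hmem x).1 hx).1)
          (fun x hx => ?_) (fun x hx => ?_) _ subset_rfl ?_ fun z hz _ _ _ => hz,
        fun x hx => ((hmem x).1 hx).2,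
        fun s hs hst x hx => (hmem x).2 ⟨hs.1 hx, hst x hx⟩⟩
      · exact hdist x (((hmem x).1 hx).2).1 _ (barycenter_mem_openStar ht).1
      · obtain ⟨m, hmX, hmt, hm⟩ := (hX t ht).2 _
          (lineMap_mem_openStar htne ((hmem x).1 hx).2 hc0 hc1)
        exact ⟨m, (hmem m).2 ⟨hmX, hmt⟩, hm⟩
      · exact (hmem _).2 ⟨(hX t ht).1, barycenter_mem_openStar ht⟩
  obtain ⟨e''⟩ := nonempty_homotopyEquiv_space hK
  exact ⟨(e'.symm.trans e).trans e''⟩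

end Polyhedron

/-- **Universality of Euclidean Rips complexes.** For every finite simplicial complex `K`
linearly embedded in `ℝⁿ` (a geometric simplicial complex with finitely many faces) there
are a scale `ε > 0` and a finite subset `X` of the underlying polyhedron `|K| ⊆ ℝⁿ` such
that the Rips complex `R(X; ε)` is homotopy equivalent to `|K|`. Consequently every
finite simplicial complex that is PL-embeddable in `ℝⁿ` is homotopy equivalent to the
Rips complex of a finite subset of `ℝⁿ`. -/
theorem rips_universality (n : ℕ) (K : Geometry.SimplicialComplex ℝ (EuclideanSpace ℝ (Fin n)))
    (hK : K.faces.Finite) :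
    ∃ ε : ℝ, 0 < ε ∧ ∃ X : Set (EuclideanSpace ℝ (Fin n)), X ⊆ K.space ∧ X.Finite ∧
      Nonempty (ContinuousMap.HomotopyEquiv (ripsRealization X ε) K.space) := by
  obtain ⟨ε, hε, X, hXK, hX, h⟩ := exists_ripsFaces_homotopyEquiv_space hK
  refine ⟨ε, hε, X, hXK, hX, ?_⟩
  rwa [ripsRealization_eq X hε]
end

section
/- Let X ⊆ ℝ³ be a finite set and v ∈ X. Then for every point x ∈ S(X^v) ∩ S(X − {v}) there is a continuous path, lying entirely inside S(X^v) ∩ S(X − {v}), from x to a point of S(X_v). Consequently the inclusion S(X_v) ↪ S(X^v) ∩ S(X − {v}) is surjective on path components. -/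
open Metric

/-- The shadow `S(X; r) ⊆ ℝⁿ` of a set `X ⊆ ℝⁿ` at scale `r`: the union of the convex
hulls of the finite subsets of `X` of diameter less than `r`. -/
def shadow (n : ℕ) (X : Set (EuclideanSpace ℝ (Fin n))) (r : ℝ) :
    Set (EuclideanSpace ℝ (Fin n)) :=
  {y | ∃ Y : Finset (EuclideanSpace ℝ (Fin n)), (Y : Set (EuclideanSpace ℝ (Fin n))) ⊆ X ∧
    Metric.diam (Y : Set (EuclideanSpace ℝ (Fin n))) < r ∧
    y ∈ convexHull ℝ (Y : Set (EuclideanSpace ℝ (Fin n)))}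

section Crossing

variable {ι E : Type*} [NormedAddCommGroup E] [InnerProductSpace ℝ E]

/-- The parallel axis identity: the second moment about `y` is the second moment about the
barycentre plus the squared distance from `y` to the barycentre. -/
lemma sum_mul_dist_sq_eq (I : Finset ι) (u : ι → ℝ) (z : ι → E) (hu : ∑ i ∈ I, u i = 1) (y : E) :
    ∑ i ∈ I, u i * dist (z i) y ^ 2 =
      dist (∑ i ∈ I, u i • z i) y ^ 2 +
        ∑ i ∈ I, u i * dist (z i) (∑ j ∈ I, u j • z j) ^ 2 := by
  set e := ∑ i ∈ I, u i • z i with he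
  have hterm : ∀ i, u i * dist (z i) y ^ 2 =
      u i * dist (z i) e ^ 2 + 2 * inner ℝ (u i • (z i - e)) (e - y) + u i * dist e y ^ 2 := by
    intro i
    have h : z i - y = (z i - e) + (e - y) := by abel
    rw [dist_eq_norm, dist_eq_norm, dist_eq_norm, h, norm_add_sq_real, inner_smul_left]
    simp only [conj_trivial]
    ring
  have hzero : ∑ i ∈ I, u i • (z i - e) = 0 := by
    simp only [smul_sub, Finset.sum_sub_distrib, ← Finset.sum_smul, hu, one_smul, ← he, sub_self]
  rw [Finset.sum_congr rfl fun i _ => hterm i, Finset.sum_add_distrib, Finset.sum_add_distrib,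
    ← Finset.mul_sum, ← sum_inner, hzero, inner_zero_left, ← Finset.sum_mul, hu]
  ring

lemma sum_mul_lt_of_sum_eq_one (I : Finset ι) (u f : ι → ℝ) (c : ℝ) (hpos : ∀ i ∈ I, 0 < u i)
    (hu : ∑ i ∈ I, u i = 1) (hf : ∀ i ∈ I, f i < c) : ∑ i ∈ I, u i * f i < c := by
  have hne : I.Nonempty := Finset.nonempty_of_sum_ne_zero (by rw [hu]; exact one_ne_zero)
  calc ∑ i ∈ I, u i * f i < ∑ i ∈ I, u i * c :=
        Finset.sum_lt_sum_of_nonempty hne fun i hi => mul_lt_mul_of_pos_left (hf i hi) (hpos i hi)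
    _ = c := by rw [← Finset.sum_mul, hu, one_mul]

lemma le_sum_mul_of_sum_eq_one (I : Finset ι) (u f : ι → ℝ) (c : ℝ) (hpos : ∀ i ∈ I, 0 < u i)
    (hu : ∑ i ∈ I, u i = 1) (hf : ∀ i ∈ I, c ≤ f i) : c ≤ ∑ i ∈ I, u i * f i := by
  calc c = ∑ i ∈ I, u i * c := by rw [← Finset.sum_mul, hu, one_mul]
    _ ≤ ∑ i ∈ I, u i * f i :=
        Finset.sum_le_sum fun i hi => mul_le_mul_of_nonneg_left (hf i hi) (hpos i hi).le

/-- If the segment `[e, f]` between the barycentres of two families meets a segment `[p, q]` of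
length less than one, and all points of the two families are less than one apart, then the first
family cannot avoid the unit ball at `p` while the second avoids the unit ball at `q`. -/
lemma false_of_segments_cross (P Q : Finset ι) (u u' : ι → ℝ) (z : ι → E)
    (hu : ∑ i ∈ P, u i = 1) (hu' : ∑ i ∈ Q, u' i = 1)
    (hpos : ∀ i ∈ P, 0 < u i) (hpos' : ∀ i ∈ Q, 0 < u' i)
    (hz : ∀ i ∈ P, ∀ j ∈ Q, dist (z i) (z j) < 1) {p q x : E} (hpq : dist p q < 1)
    (hx : x ∈ segment ℝ p q) (hx' : x ∈ segment ℝ (∑ i ∈ P, u i • z i) (∑ i ∈ Q, u' i • z i))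
    (hp : ∀ i ∈ P, 1 ≤ dist (z i) p) (hq : ∀ i ∈ Q, 1 ≤ dist (z i) q) : False := by
  have hP := sum_mul_dist_sq_eq P u z hu
  have hQ := sum_mul_dist_sq_eq Q u' z hu'
  set e := ∑ i ∈ P, u i • z i
  set f := ∑ i ∈ Q, u' i • z i
  set vP := ∑ i ∈ P, u i * dist (z i) e ^ 2
  set vQ := ∑ i ∈ Q, u' i * dist (z i) f ^ 2
  have hvP0 : 0 ≤ vP := Finset.sum_nonneg fun i hi => mul_nonneg (hpos i hi).le (sq_nonneg _)
  have hvQ0 : 0 ≤ vQ := Finset.sum_nonneg fun i hi => mul_nonneg (hpos' i hi).le (sq_nonneg _)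
  have h₁ : 1 ≤ dist e p ^ 2 + vP := by
    rw [← hP]
    exact le_sum_mul_of_sum_eq_one P u _ 1 hpos hu fun i hi => one_le_pow₀ (hp i hi)
  have h₂ : 1 ≤ dist f q ^ 2 + vQ := by
    rw [← hQ]
    exact le_sum_mul_of_sum_eq_one Q u' _ 1 hpos' hu' fun i hi => one_le_pow₀ (hq i hi)
  have h₃ : dist f e ^ 2 + vQ < 1 - vP := by
    rw [← hQ]
    refine sum_mul_lt_of_sum_eq_one Q u' _ _ hpos' hu' fun j hj => ?_
    have h := sum_mul_lt_of_sum_eq_one P u (fun i => dist (z i) (z j) ^ 2) 1 hpos hu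
      fun i hi => pow_lt_one₀ dist_nonneg (hz i hi j hj) two_ne_zero
    rw [hP, dist_comm] at h
    linarith
  have h₄ : dist e p + dist f q ≤ dist f e + dist p q := by
    have a₁ := dist_add_dist_of_mem_segment hx
    have a₂ := dist_add_dist_of_mem_segment hx'
    have a₃ := dist_triangle e x p
    have a₄ := dist_triangle f x q
    rw [dist_comm x p] at a₃
    rw [dist_comm f x] at a₄
    rw [dist_comm f e]
    linarith
  have hA : 0 ≤ dist e p := dist_nonneg
  have hB : 0 ≤ dist f q := dist_nonneg
  have hC : 0 ≤ dist f e := dist_nonneg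
  have hD : 0 ≤ dist p q := dist_nonneg
  have hAB : dist f e ≤ dist e p * dist f q := by
    refine le_of_sq_le_sq ?_ (mul_nonneg hA hB)
    rw [mul_pow]
    nlinarith [mul_nonneg hvP0 hvQ0, sq_nonneg (dist f e),
      mul_le_mul (sub_le_iff_le_add.2 h₁) (sub_le_iff_le_add.2 h₂)
        (by nlinarith [sq_nonneg (dist f e)]) (sq_nonneg (dist e p))]
  nlinarith

/-- A weighted family of points splits at its barycentre: the barycentres of the two parts span
a segment through the barycentre of the whole. -/
lemma mem_segment_barycenter_of_disjoint_union (P Q : Finset ι) (w : ι → ℝ) (z : ι → E)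
    (hP : 0 < ∑ i ∈ P, w i) (hQ : 0 < ∑ i ∈ Q, w i)
    (hw : ∑ i ∈ P, w i + ∑ i ∈ Q, w i = 1) :
    ∑ i ∈ P, w i • z i + ∑ i ∈ Q, w i • z i ∈ segment ℝ
      (∑ i ∈ P, ((∑ j ∈ P, w j)⁻¹ * w i) • z i) (∑ i ∈ Q, ((∑ j ∈ Q, w j)⁻¹ * w i) • z i) := by
  refine ⟨_, _, hP.le, hQ.le, hw, ?_⟩
  simp only [mul_smul, ← Finset.smul_sum, smul_inv_smul₀ hP.ne', smul_inv_smul₀ hQ.ne']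

lemma false_of_far_partition (P Q : Finset ι) (w : ι → ℝ) (z : ι → E)
    (hPne : P.Nonempty) (hQne : Q.Nonempty)
    (hposP : ∀ i ∈ P, 0 < w i) (hposQ : ∀ i ∈ Q, 0 < w i)
    (hw : ∑ i ∈ P, w i + ∑ i ∈ Q, w i = 1)
    (hz : ∀ i ∈ P, ∀ j ∈ Q, dist (z i) (z j) < 1) {p q : E} (hpq : dist p q < 1)
    (hx : ∑ i ∈ P, w i • z i + ∑ i ∈ Q, w i • z i ∈ segment ℝ p q)
    (hp : ∀ i ∈ P, 1 ≤ dist (z i) p) (hq : ∀ i ∈ Q, 1 ≤ dist (z i) q) : False := by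
  have hP := Finset.sum_pos hposP hPne
  have hQ := Finset.sum_pos hposQ hQne
  refine false_of_segments_cross P Q _ _ z ?_ ?_ ?_ ?_ hz hpq hx
    (mem_segment_barycenter_of_disjoint_union P Q w z hP hQ hw) hp hq
  · rw [← Finset.mul_sum, inv_mul_cancel₀ hP.ne']
  · rw [← Finset.mul_sum, inv_mul_cancel₀ hQ.ne']
  · exact fun i hi => mul_pos (inv_pos.2 hP) (hposP i hi)
  · exact fun i hi => mul_pos (inv_pos.2 hQ) (hposQ i hi)

/-- If a segment of length less than one contains a point in the relative interior of the hull of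
a family of points less than one apart, then some vertex of one of the two is at distance less
than one from all vertices of the other. -/
lemma exists_near_vertex_of_mem_segment (I : Finset ι) (w : ι → ℝ) (z : ι → E)
    (hpos : ∀ i ∈ I, 0 < w i) (hw : ∑ i ∈ I, w i = 1)
    (hz : ∀ i ∈ I, ∀ j ∈ I, dist (z i) (z j) < 1) {p q : E} (hpq : dist p q < 1)
    (hx : ∑ i ∈ I, w i • z i ∈ segment ℝ p q) :
    (∃ i ∈ I, dist (z i) p < 1 ∧ dist (z i) q < 1) ∨
      (∀ i ∈ I, dist (z i) p < 1) ∨ (∀ i ∈ I, dist (z i) q < 1) := by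
  classical
  by_contra! ⟨hfar, ⟨i₀, hi₀, hi₀p⟩, ⟨j₀, hj₀, hj₀q⟩⟩
  by_cases hall : ∀ i ∈ I, 1 ≤ dist (z i) p
  · by_cases hne : (I.erase j₀).Nonempty
    · refine false_of_far_partition (I.erase j₀) {j₀} w z hne (Finset.singleton_nonempty _)
        (fun i hi => hpos i (Finset.mem_of_mem_erase hi)) (by simpa using hpos j₀ hj₀) ?_
        (fun i hi j hj => ?_) hpq ?_ (fun i hi => hall i (Finset.mem_of_mem_erase hi))
        (by simpa using hj₀q)
      · rw [Finset.sum_singleton, Finset.sum_erase_add _ _ hj₀, hw]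
      · rw [Finset.mem_singleton.1 hj]
        exact hz i (Finset.mem_of_mem_erase hi) j₀ hj₀
      · rwa [Finset.sum_singleton, Finset.sum_erase_add _ _ hj₀]
    · have hI : I = {j₀} := by
        rw [Finset.not_nonempty_iff_eq_empty, Finset.erase_eq_empty_iff] at hne
        exact hne.resolve_left (Finset.ne_empty_of_mem hj₀)
      rw [hI, Finset.sum_singleton] at hw hx
      rw [hw, one_smul] at hx
      have h₁ := dist_add_dist_of_mem_segment hx
      have h₂ : 0 ≤ dist p (z j₀) := dist_nonneg
      linarith
  · push Not at hall
    obtain ⟨k, hk, hkp⟩ := hall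
    refine false_of_far_partition (I.filter fun i => 1 ≤ dist (z i) p)
      (I.filter fun i => ¬ 1 ≤ dist (z i) p) w z ⟨i₀, by simp [hi₀, hi₀p]⟩
      ⟨k, by simp [hk, hkp]⟩ (fun i hi => hpos i (Finset.mem_filter.1 hi).1)
      (fun i hi => hpos i (Finset.mem_filter.1 hi).1) ?_
      (fun i hi j hj => hz i (Finset.mem_filter.1 hi).1 j (Finset.mem_filter.1 hj).1) hpq ?_
      (fun i hi => (Finset.mem_filter.1 hi).2) (fun i hi => ?_)
    · rw [Finset.sum_filter_add_sum_filter_not, hw]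
    · rwa [Finset.sum_filter_add_sum_filter_not]
    · obtain ⟨hi, hip⟩ := Finset.mem_filter.1 hi
      exact hfar i hi (not_le.1 hip)

lemma exists_near_vertex_of_card_le_two (I J : Finset ι) (w : ι → ℝ) (z z' : ι → E)
    (hposI : ∀ i ∈ I, 0 < w i) (hposJ : ∀ i ∈ J, 0 < w i)
    (hwI : ∑ i ∈ I, w i = 1) (hwJ : ∑ i ∈ J, w i = 1)
    (hzI : ∀ i ∈ I, ∀ j ∈ I, dist (z i) (z j) < 1)
    (hzJ : ∀ i ∈ J, ∀ j ∈ J, dist (z' i) (z' j) < 1)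
    (hx : ∑ i ∈ I, w i • z i = ∑ i ∈ J, w i • z' i) (hcard : J.card ≤ 2) :
    (∃ i ∈ I, ∀ j ∈ J, dist (z i) (z' j) < 1) ∨ (∃ j ∈ J, ∀ i ∈ I, dist (z i) (z' j) < 1) := by
  classical
  have hne : J.Nonempty := Finset.nonempty_of_sum_ne_zero (by rw [hwJ]; exact one_ne_zero)
  obtain ⟨a, b, rfl, hseg⟩ : ∃ a b, J = {a, b} ∧ ∑ i ∈ J, w i • z' i ∈ segment ℝ (z' a) (z' b) := by
    obtain h | h : J.card = 1 ∨ J.card = 2 := by have := hne.card_pos; omega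
    · obtain ⟨a, rfl⟩ := Finset.card_eq_one.1 h
      rw [Finset.sum_singleton] at hwJ
      exact ⟨a, a, by simp, by simp [hwJ]⟩
    · obtain ⟨a, b, hab, rfl⟩ := Finset.card_eq_two.1 h
      rw [Finset.sum_pair hab] at hwJ
      exact ⟨a, b, rfl, w a, w b, (hposJ a (by simp)).le, (hposJ b (by simp)).le, hwJ,
        by rw [Finset.sum_pair hab]⟩
  rw [← hx] at hseg
  rcases exists_near_vertex_of_mem_segment I w z hposI hwI hzI
    (hzJ a (by simp) b (by simp)) hseg with ⟨i, hi, h₁, h₂⟩ | h | h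
  · exact Or.inl ⟨i, hi, by simp [h₁, h₂]⟩
  · exact Or.inr ⟨a, by simp, h⟩
  · exact Or.inr ⟨b, by simp, h⟩

end Crossing

section Reduction

open Module
open scoped Pointwise

universe u

variable {E : Type u} [AddCommGroup E] [Module ℝ E] [FiniteDimensional ℝ E]

/-- A simultaneous Carathéodory theorem: if the hulls of `S` and `T` meet, then so do the relative
interiors of the hulls of some families from `S` and `T` with at most `finrank ℝ E + 2` members
in total. -/
lemma exists_crossing_families {S T : Set E} {x : E} (hS : x ∈ convexHull ℝ S)
    (hT : x ∈ convexHull ℝ T) :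
    ∃ (ι : Type u) (I J : Finset ι) (w : ι → ℝ) (z z' : ι → E),
      (∀ i ∈ I, z i ∈ S) ∧ (∀ i ∈ J, z' i ∈ T) ∧ (∀ i ∈ I, 0 < w i) ∧ (∀ i ∈ J, 0 < w i) ∧
      ∑ i ∈ I, w i = 1 ∧ ∑ i ∈ J, w i = 1 ∧ ∑ i ∈ I, w i • z i = ∑ i ∈ J, w i • z' i ∧
      I.card + J.card ≤ finrank ℝ E + 2 := by
  classical
  have hzero : (0 : E × ℝ) ∈ convexHull ℝ (S ×ˢ {(1 : ℝ)} ∪ (-T) ×ˢ {(-1 : ℝ)}) := by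
    have h₁ : (x, (1 : ℝ)) ∈ convexHull ℝ (S ×ˢ {(1 : ℝ)} ∪ (-T) ×ˢ {(-1 : ℝ)}) := by
      refine convexHull_mono Set.subset_union_left ?_
      rw [convexHull_prod]
      exact ⟨hS, by simp⟩
    have h₂ : (-x, (-1 : ℝ)) ∈ convexHull ℝ (S ×ˢ {(1 : ℝ)} ∪ (-T) ×ˢ {(-1 : ℝ)}) := by
      refine convexHull_mono Set.subset_union_right ?_
      rw [convexHull_prod, convexHull_neg]
      exact ⟨by simpa using hT, by simp⟩
    have h := (convex_convexHull ℝ _) h₁ h₂ (a := 1 / 2) (b := 1 / 2) (by norm_num) (by norm_num)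
      (by norm_num)
    simpa [← Prod.zero_eq_mk] using h
  obtain ⟨ι, _, z, w, hz, hind, hpos, hsum, hcomb⟩ := eq_pos_convex_span_of_mem_convexHull hzero
  have hmem : ∀ i, (z i).1 ∈ S ∧ (z i).2 = 1 ∨ -(z i).1 ∈ T ∧ (z i).2 = -1 := fun i => by
    simpa using hz ⟨i, rfl⟩
  have hJ : ∀ i, (z i).2 ≠ 1 → -(z i).1 ∈ T ∧ (z i).2 = -1 := fun i hi =>
    (hmem i).resolve_left fun h => hi h.2
  have hI : ∀ i, (z i).2 = 1 → (z i).1 ∈ S := fun i hi =>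
    (hmem i).elim (fun h => h.1) fun h => by norm_num [h.2] at hi
  set I : Finset ι := Finset.univ.filter fun i => (z i).2 = 1 with hIdef
  set J : Finset ι := Finset.univ.filter fun i => ¬ (z i).2 = 1 with hJdef
  have hsplit : ∑ i ∈ I, w i + ∑ i ∈ J, w i = 1 := by
    rw [hIdef, hJdef, Finset.sum_filter_add_sum_filter_not, hsum]
  have hsnd : ∑ i ∈ I, w i - ∑ i ∈ J, w i = 0 := by
    have h : ∑ i, w i * (z i).2 = 0 := by
      simpa [Prod.snd_sum] using congrArg Prod.snd hcomb
    rw [← Finset.sum_filter_add_sum_filter_not _ (fun i => (z i).2 = 1)] at h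
    rw [← h, sub_eq_add_neg, ← Finset.sum_neg_distrib]
    congr 1
    · exact Finset.sum_congr rfl fun i hi => by rw [(Finset.mem_filter.1 hi).2, mul_one]
    · exact Finset.sum_congr rfl fun i hi => by
        rw [(hJ i (Finset.mem_filter.1 hi).2).2, mul_neg_one]
  have hfst : ∑ i ∈ I, w i • (z i).1 + ∑ i ∈ J, w i • (z i).1 = 0 := by
    rw [hIdef, hJdef, Finset.sum_filter_add_sum_filter_not]
    simpa [Prod.fst_sum] using congrArg Prod.fst hcomb
  refine ⟨ι, I, J, fun i => 2 * w i, fun i => (z i).1, fun i => -(z i).1,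
    fun i hi => hI i (Finset.mem_filter.1 hi).2, fun i hi => (hJ i (Finset.mem_filter.1 hi).2).1,
    fun i _ => mul_pos two_pos (hpos i), fun i _ => mul_pos two_pos (hpos i), ?_, ?_, ?_, ?_⟩
  · rw [← Finset.mul_sum]
    linarith
  · rw [← Finset.mul_sum]
    linarith
  · simp only [mul_smul, smul_neg, Finset.sum_neg_distrib, ← Finset.smul_sum]
    rw [eq_neg_of_add_eq_zero_left hfst, smul_neg]
  · rw [hIdef, hJdef, Finset.card_filter_add_card_filter_not, Finset.card_univ]
    refine hind.card_le_finrank_succ.trans (Nat.succ_le_succ ?_)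
    refine (Submodule.finrank_le _).trans ?_
    rw [finrank_prod, finrank_self]

end Reduction

lemma Finset.diam_lt_of_forall_dist_lt {E : Type*} [PseudoMetricSpace E] (Y : Finset E) {r : ℝ}
    (hr : 0 < r) (h : ∀ a ∈ Y, ∀ b ∈ Y, dist a b < r) : diam (Y : Set E) < r := by
  rcases Y.eq_empty_or_nonempty with rfl | hne
  · simpa using hr
  obtain ⟨⟨a, b⟩, hab, hmax⟩ := (Y ×ˢ Y).exists_max_image (fun c => dist c.1 c.2) (hne.product hne)
  rw [Finset.mem_product] at hab
  refine lt_of_le_of_lt (diam_le_of_forall_dist_le dist_nonneg fun c hc d hd => ?_)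
    (h a hab.1 b hab.2)
  exact hmax (c, d) (Finset.mem_product.2 ⟨hc, hd⟩)

lemma Finset.dist_lt_of_diam_lt {E : Type*} [PseudoMetricSpace E] {Y : Finset E} {r : ℝ}
    (h : diam (Y : Set E) < r) {a b : E} (ha : a ∈ Y) (hb : b ∈ Y) : dist a b < r :=
  (dist_le_diam_of_mem Y.finite_toSet.isBounded ha hb).trans_lt h

/-- If the hulls of two finite sets of diameter less than one in `ℝ³` meet, then the hulls of
some faces of them meet such that a vertex of one face is near all vertices of the other. -/
lemma exists_faces_with_near_vertex (Y Z : Finset (EuclideanSpace ℝ (Fin 3)))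
    (hY : diam (Y : Set (EuclideanSpace ℝ (Fin 3))) < 1)
    (hZ : diam (Z : Set (EuclideanSpace ℝ (Fin 3))) < 1) {x : EuclideanSpace ℝ (Fin 3)}
    (hxY : x ∈ convexHull ℝ (Y : Set (EuclideanSpace ℝ (Fin 3))))
    (hxZ : x ∈ convexHull ℝ (Z : Set (EuclideanSpace ℝ (Fin 3)))) :
    ∃ σ ⊆ Y, ∃ τ ⊆ Z, ∃ y ∈ convexHull ℝ (σ : Set (EuclideanSpace ℝ (Fin 3))),
      y ∈ convexHull ℝ (τ : Set (EuclideanSpace ℝ (Fin 3))) ∧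
      ((∃ a ∈ σ, ∀ b ∈ τ, dist a b < 1) ∨ (∃ b ∈ τ, ∀ a ∈ σ, dist a b < 1)) := by
  classical
  obtain ⟨ι, I, J, w, z, z', hzI, hzJ, hposI, hposJ, hwI, hwJ, heq, hcard⟩ :=
    exists_crossing_families hxY hxZ
  rw [finrank_euclideanSpace_fin] at hcard
  have hnear : (∃ i ∈ I, ∀ j ∈ J, dist (z i) (z' j) < 1) ∨
      (∃ j ∈ J, ∀ i ∈ I, dist (z i) (z' j) < 1) := by
    have hdI : ∀ i ∈ I, ∀ j ∈ I, dist (z i) (z j) < 1 := fun i hi j hj =>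
      Finset.dist_lt_of_diam_lt hY (hzI i hi) (hzI j hj)
    have hdJ : ∀ i ∈ J, ∀ j ∈ J, dist (z' i) (z' j) < 1 := fun i hi j hj =>
      Finset.dist_lt_of_diam_lt hZ (hzJ i hi) (hzJ j hj)
    rcases le_or_gt J.card 2 with h | h
    · exact exists_near_vertex_of_card_le_two I J w z z' hposI hposJ hwI hwJ hdI hdJ heq h
    · have := exists_near_vertex_of_card_le_two J I w z' z hposJ hposI hwJ hwI hdJ hdI heq.symm
        (by omega)
      simpa only [dist_comm] using this.symm
  refine ⟨I.image z, Finset.image_subset_iff.2 hzI, J.image z', Finset.image_subset_iff.2 hzJ,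
    ∑ i ∈ I, w i • z i, ?_, ?_, by simpa using hnear⟩
  · exact (convex_convexHull ℝ _).sum_mem (fun i hi => (hposI i hi).le) hwI fun i hi =>
      subset_convexHull ℝ _ (Finset.mem_coe.2 (Finset.mem_image_of_mem z hi))
  · rw [heq]
    exact (convex_convexHull ℝ _).sum_mem (fun i hi => (hposJ i hi).le) hwJ fun i hi =>
      subset_convexHull ℝ _ (Finset.mem_coe.2 (Finset.mem_image_of_mem z' hi))

section Shadow

variable {n : ℕ} {A B : Set (EuclideanSpace ℝ (Fin n))} {r : ℝ}

lemma convexHull_subset_shadow {Y : Finset (EuclideanSpace ℝ (Fin n))}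
    (hYA : (Y : Set (EuclideanSpace ℝ (Fin n))) ⊆ A)
    (hY : diam (Y : Set (EuclideanSpace ℝ (Fin n))) < r) :
    convexHull ℝ (Y : Set (EuclideanSpace ℝ (Fin n))) ⊆ shadow n A r :=
  fun _ hy => ⟨Y, hYA, hY, hy⟩

lemma joinedIn_shadow_inter_of_mem_convexHull {Y Z : Finset (EuclideanSpace ℝ (Fin n))}
    (hYA : (Y : Set (EuclideanSpace ℝ (Fin n))) ⊆ A)
    (hY : diam (Y : Set (EuclideanSpace ℝ (Fin n))) < r)
    (hZB : (Z : Set (EuclideanSpace ℝ (Fin n))) ⊆ B)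
    (hZ : diam (Z : Set (EuclideanSpace ℝ (Fin n))) < r) {x y : EuclideanSpace ℝ (Fin n)}
    (hxY : x ∈ convexHull ℝ (Y : Set (EuclideanSpace ℝ (Fin n))))
    (hxZ : x ∈ convexHull ℝ (Z : Set (EuclideanSpace ℝ (Fin n))))
    (hyY : y ∈ convexHull ℝ (Y : Set (EuclideanSpace ℝ (Fin n))))
    (hyZ : y ∈ convexHull ℝ (Z : Set (EuclideanSpace ℝ (Fin n)))) :
    JoinedIn (shadow n A r ∩ shadow n B r) x y := by
  refine JoinedIn.of_segment_subset (Set.subset_inter ?_ ?_)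
  · exact ((convex_convexHull ℝ _).segment_subset hxY hyY).trans (convexHull_subset_shadow hYA hY)
  · exact ((convex_convexHull ℝ _).segment_subset hxZ hyZ).trans (convexHull_subset_shadow hZB hZ)

end Shadow

lemma Finset.diam_insert_lt {E : Type*} [PseudoMetricSpace E] [DecidableEq E] {Y : Finset E}
    {r : ℝ} {b : E} (hr : 0 < r) (hY : ∀ a ∈ Y, ∀ a' ∈ Y, dist a a' < r)
    (hb : ∀ a ∈ Y, dist a b < r) : diam ((insert b Y : Finset E) : Set E) < r := by
  refine Finset.diam_lt_of_forall_dist_lt _ hr fun c hc d hd => ?_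
  rcases Finset.mem_insert.1 hc with rfl | hc' <;> rcases Finset.mem_insert.1 hd with rfl | hd'
  · simpa using hr
  · rw [dist_comm]
    exact hb d hd'
  · exact hb c hc'
  · exact hY c hc' d hd'

/-- **Local `π₀`-surjectivity of shadows in `ℝ³`.** Let `X ⊆ ℝ³` be finite and `v ∈ X`.
Write `X^v = X ∩ B(v,1)` and `X_v = (X ∖ {v}) ∩ B(v,1)`. Every point
`x ∈ S(X^v) ∩ S(X − v)` can be joined, by a path lying inside `S(X^v) ∩ S(X − v)`,
to a point of `S(X_v)`; hence the inclusion `S(X_v) ↪ S(X^v) ∩ S(X − v)` is surjective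
on path components. -/
theorem shadow_link_pi0_surjective (X : Set (EuclideanSpace ℝ (Fin 3))) (hX : X.Finite)
    (v : EuclideanSpace ℝ (Fin 3)) (hv : v ∈ X) :
    ∀ x ∈ shadow 3 (X ∩ ball v 1) 1 ∩ shadow 3 (X \ {v}) 1,
      ∃ y ∈ shadow 3 ((X \ {v}) ∩ ball v 1) 1,
        JoinedIn (shadow 3 (X ∩ ball v 1) 1 ∩ shadow 3 (X \ {v}) 1) x y := by
  classical
  rintro x ⟨⟨Y, hYX, hY, hxY⟩, ⟨Z, hZX, hZ, hxZ⟩⟩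
  obtain ⟨σ, hσ, τ, hτ, y, hyσ, hyτ, hnear⟩ := exists_faces_with_near_vertex Y Z hY hZ hxY hxZ
  have hyY := convexHull_mono (𝕜 := ℝ) (Finset.coe_subset.2 hσ) hyσ
  have hyZ := convexHull_mono (𝕜 := ℝ) (Finset.coe_subset.2 hτ) hyτ
  have hdσ : ∀ a ∈ σ, ∀ b ∈ σ, dist a b < 1 := fun a ha b hb =>
    Finset.dist_lt_of_diam_lt hY (hσ ha) (hσ hb)
  have hdτ : ∀ a ∈ τ, ∀ b ∈ τ, dist a b < 1 := fun a ha b hb =>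
    Finset.dist_lt_of_diam_lt hZ (hτ ha) (hτ hb)
  have hxy := joinedIn_shadow_inter_of_mem_convexHull hYX hY hZX hZ hxY hxZ hyY hyZ
  have hpoint : ∀ a ∈ (X \ {v}) ∩ ball v 1, a ∈ shadow 3 ((X \ {v}) ∩ ball v 1) 1 := fun a ha =>
    ⟨{a}, by simpa using ha, by simp, by simp⟩
  by_cases hvσ : v ∈ σ
  swap
  · refine ⟨y, ⟨σ, fun a ha => ⟨⟨(hYX (hσ ha)).1, ?_⟩, (hYX (hσ ha)).2⟩,
      Finset.diam_lt_of_forall_dist_lt σ one_pos hdσ, hyσ⟩, hxy⟩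
    rintro rfl
    exact hvσ ha
  rcases hnear with ⟨a, ha, hnear⟩ | ⟨b, hb, hnear⟩
  · by_cases hav : a = v
    · refine ⟨y, ⟨τ, fun b hb => ⟨hZX (hτ hb), ?_⟩,
        Finset.diam_lt_of_forall_dist_lt τ one_pos hdτ, hyτ⟩, hxy⟩
      rw [mem_ball, dist_comm, ← hav]
      exact hnear b hb
    · have haX : a ∈ (X \ {v}) ∩ ball v 1 := ⟨⟨(hYX (hσ ha)).1, hav⟩, (hYX (hσ ha)).2⟩
      refine ⟨a, hpoint a haX, hxy.trans (joinedIn_shadow_inter_of_mem_convexHull hYX hY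
        (Z := insert a τ) ?_ ?_ hyY ?_ (subset_convexHull ℝ _ (hσ ha))
        (subset_convexHull ℝ _ (by simp)))⟩
      · rw [Finset.coe_insert]
        exact Set.insert_subset haX.1 ((Finset.coe_subset.2 hτ).trans hZX)
      · exact Finset.diam_insert_lt one_pos hdτ fun b hb => by
          rw [dist_comm]
          exact hnear b hb
      · exact convexHull_mono (by simp) hyτ
  · have hbX : b ∈ (X \ {v}) ∩ ball v 1 := by
      refine ⟨hZX (hτ hb), ?_⟩
      rw [mem_ball, dist_comm]
      exact hnear v hvσ
    refine ⟨b, hpoint b hbX, hxy.trans (joinedIn_shadow_inter_of_mem_convexHull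
      (Y := insert b σ) ?_ (Finset.diam_insert_lt one_pos hdσ hnear) hZX hZ
      (convexHull_mono (by simp) hyσ) hyZ (subset_convexHull ℝ _ (by simp))
      (subset_convexHull ℝ _ (hτ hb)))⟩
    rw [Finset.coe_insert]
    exact Set.insert_subset ⟨hbX.1.1, hbX.2⟩ ((Finset.coe_subset.2 hσ).trans hYX)
end
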